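/- Let η ≥ ℵ₀ and λ be cardinals with λ^{<η} = λ ≥ ℵ₀, and let κ be an infinite cardinal. Then Add(η,λ) is κ-descending distributive if and only if cf(κ) < cf(η) or cf(κ) > λ^{<η}. -/

import Mathlib

universe u

open Cardinal

/-- A subset `D` of a forcing notion is *open dense* if it is downward closed and
for every condition `p` there is `q ∈ D` with `q ≤ p`. -/
def IsOpenDense {P : Type*} [Preorder P] (D : Set P) : Prop :=
  (∀ p ∈ D, ∀ q, q ≤ p → q ∈ D) ∧ ∀ p : P, ∃ q ∈ D, q ≤ p

/-- A forcing notion `P` is `κ`-descending distributive if for every decreasing sequence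
`(D_α)_{α<κ}` of open dense subsets, the intersection `⋂_{α<κ} D_α` is open dense. -/
def DescDist (P : Type*) [Preorder P] (κ : Cardinal) : Prop :=
  ∀ D : Ordinal → Set P,
    (∀ α, α < κ.ord → IsOpenDense (D α)) →
    (∀ α β : Ordinal, α ≤ β → β < κ.ord → D β ⊆ D α) →
    IsOpenDense (⋂ α ∈ Set.Iio κ.ord, D α)

/-- Conditions of the Cohen forcing `Add(η,λ)`: partial functions `p : λ × η → 2`
(coded by their functional graphs) whose domain has cardinality less than `η`. -/
def AddCond (η lam : Cardinal.{u}) : Type u :=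
  {s : Set ((lam.out × η.out) × Bool) //
    (∀ a b b', (a, b) ∈ s → (a, b') ∈ s → b = b') ∧
    Cardinal.mk (Prod.fst '' s) < η}

/-- `Add(η,λ)` is ordered by reverse inclusion of graphs: `q ≤ p` iff `q ⊇ p`. -/
instance (η lam : Cardinal.{u}) : PartialOrder (AddCond η lam) where
  le q p := p.1 ⊆ q.1
  le_refl p := subset_rfl
  le_trans a b c hab hbc := fun x hx => hab (hbc hx)
  le_antisymm a b hab hba := Subtype.ext (Set.Subset.antisymm hba hab)

section

open Ordinal Set

theorem Ordinal.exists_cofinal_family {o : Ordinal.{u}} (ho : Order.IsSuccLimit o) :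
    ∃ (ι : Type u) (f : ι → Ordinal.{u}), #ι = o.cof ∧ (∀ i, f i < o) ∧
      (∀ a < o, ∃ i, a < f i) ∧ ∀ a < o, #{i // f i ≤ a} < o.cof := by
  obtain ⟨s, hs, hs'⟩ := exists_ord_cof_eq o.ToType
  rw [cof_toType] at hs'
  have hlt : ∀ a < o, ∃ i : s, a < (i.1.toOrd : Ordinal) := by
    intro a ha
    obtain ⟨i, hi, hle⟩ := hs (ToType.mk ⟨a + 1, ho.add_one_lt ha⟩)
    refine ⟨⟨i, hi⟩, ?_⟩
    have := ToType.mk.symm.monotone hle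
    rw [OrderIso.symm_apply_apply] at this
    exact (lt_add_one a).trans_le this
  refine ⟨s, fun i => i.1.toOrd, ?_, fun i => i.1.toOrd.2, hlt, fun a ha => ?_⟩
  · rw [← card_type (· < · : s → s → Prop), hs', card_ord]
  · obtain ⟨i, hi⟩ := hlt a ha
    refine (mk_subtype_le_of_subset (q := fun j => j < i) fun j hj => ?_).trans_lt
      (?_ : #(Iio i) < _)
    · exact (ToType.mk.symm.lt_iff_lt (x := j.1) (y := i.1)).1
        (Subtype.coe_lt_coe.1 (lt_of_le_of_lt hj hi))
    · have := typein_lt_type (· < · : s → s → Prop) i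
      rw [hs', lt_ord] at this
      exact this

theorem Cardinal.mk_iUnion_lt_of_lt_cof_ord {ι α : Type u} {η : Cardinal.{u}} (hη : ℵ₀ ≤ η)
    (t : ι → Set α) (hι : #ι < η.ord.cof) (h : ∀ i, #(t i) < η) : #(⋃ i, t i) < η :=
  (mk_iUnion_le t).trans_lt <| mul_lt_of_lt hη (hι.trans_le (cof_ord_le η))
    (iSup_lt_of_lt_cof_ord hι h)

theorem descDist_of_mk_lt_cof {P : Type u} [Preorder P] {κ : Cardinal.{u}}
    (h : #P < κ.ord.cof) : DescDist P κ := by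
  intro D hD hanti
  classical
  let f : P → Ordinal.{u} := fun p =>
    if hp : ∃ α < κ.ord, p ∉ D α then hp.choose else 0
  have hκ : 0 < κ.ord := by
    rw [← cof_pos]
    exact pos_of_gt h
  have hf : ∀ p, f p < κ.ord := by
    intro p
    by_cases hp : ∃ α < κ.ord, p ∉ D α
    · simpa only [f, dif_pos hp] using hp.choose_spec.1
    · simpa only [f, dif_neg hp] using hκ
  have hsup := iSup_lt_of_lt_cof h hf
  have hinter : ⋂ α ∈ Iio κ.ord, D α = D (⨆ p, f p) := by
    refine Subset.antisymm (biInter_subset_of_mem hsup) fun p hp => ?_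
    by_contra hmem
    have hex : ∃ α < κ.ord, p ∉ D α := by simpa using hmem
    have hfp : p ∉ D (f p) := by simpa only [f, dif_pos hex] using hex.choose_spec.2
    exact hfp (hanti _ _ (Ordinal.le_iSup f p) hsup hp)
  rw [hinter]
  exact hD _ hsup

theorem not_descDist_of_relation {P Γ : Type u} [Preorder P] [Nonempty P] {κ : Cardinal.{u}}
    (hκ : ℵ₀ ≤ κ) (hΓ : #Γ = κ.ord.cof) (R : P → Γ → Prop)
    (hmono : ∀ p q γ, q ≤ p → R p γ → R q γ) (hdense : ∀ p γ, ∃ q ≤ p, R q γ)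
    (hsmall : ∀ p, #{γ // R p γ} < κ.ord.cof) : ¬ DescDist P κ := by
  intro hdist
  obtain ⟨ι, f, hι, hf, hcof, -⟩ := exists_cofinal_family (isSuccLimit_ord hκ)
  obtain ⟨e⟩ := Cardinal.eq.1 (hΓ.trans hι.symm)
  have := hdist (fun α => {p | ∃ γ, α ≤ f (e γ) ∧ R p γ}) ?_ ?_
  · obtain ⟨p, hp, -⟩ := this.2 (Classical.arbitrary P)
    have hsup := iSup_add_one_lt_of_lt_cof (hsmall p) fun γ => hf (e γ)
    obtain ⟨γ, hle, hR⟩ := mem_iInter₂.1 hp _ hsup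
    exact (lt_add_one _).not_ge
      ((Ordinal.le_iSup (fun γ : {γ // R p γ} => f (e γ) + 1) ⟨γ, hR⟩).trans hle)
  · refine fun α hα => ⟨?_, fun p => ?_⟩
    · rintro p ⟨γ, hle, hR⟩ q hqp
      exact ⟨γ, hle, hmono p q γ hqp hR⟩
    · obtain ⟨i, hi⟩ := hcof α hα
      obtain ⟨q, hqp, hq⟩ := hdense p (e.symm i)
      exact ⟨q, ⟨e.symm i, by simpa using hi.le, hq⟩, hqp⟩
  · rintro α β hαβ - p ⟨γ, hle, hR⟩
    exact ⟨γ, hαβ.trans hle, hR⟩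

namespace AddCond

variable {η lam : Cardinal.{u}}

/-- A graph of a partial function with domain of size less than `η`. -/
def IsCond (η : Cardinal.{u}) {X : Type u} (s : Set (X × Bool)) : Prop :=
  (∀ a b b', (a, b) ∈ s → (a, b') ∈ s → b = b') ∧ #(Prod.fst '' s) < η

theorem isCond_union_iUnion {X ι : Type u} (hη : ℵ₀ ≤ η) (hι : #ι < η.ord.cof)
    {s : Set (X × Bool)} (hs : IsCond η s) {t : ι → Set (X × Bool)} (ht : ∀ i, IsCond η (t i))
    (hst : ∀ i, s ⊆ t i) (hdir : ∀ i j, t i ⊆ t j ∨ t j ⊆ t i) :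
    IsCond η (s ∪ ⋃ i, t i) := by
  constructor
  · intro a b b' hb hb'
    simp only [mem_union, mem_iUnion] at hb hb'
    rcases hb with hb | ⟨i, hi⟩
    · rcases hb' with hb' | ⟨j, hj⟩
      · exact hs.1 a b b' hb hb'
      · exact (ht j).1 a b b' (hst j hb) hj
    · rcases hb' with hb' | ⟨j, hj⟩
      · exact (ht i).1 a b b' hi (hst i hb')
      · rcases hdir i j with h | h
        · exact (ht j).1 a b b' (h hi) hj
        · exact (ht i).1 a b b' hi (h hj)
  · rw [image_union, image_iUnion]
    exact (mk_union_le _ _).trans_lt <|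
      add_lt_of_lt hη hs.2 (mk_iUnion_lt_of_lt_cof_ord hη _ hι fun i => (ht i).2)

/-- `Add(η,λ)` is `ν`-distributive for every `ν < cf(η)`. -/
theorem exists_forall_mem_of_mk_lt_cof (hη : ℵ₀ ≤ η) {ι : Type u} (hι : #ι < η.ord.cof)
    (D : ι → Set (AddCond η lam)) (hD : ∀ i, IsOpenDense (D i)) (p : AddCond η lam) :
    ∃ q ≤ p, ∀ i, q ∈ D i := by
  classical
  let _ : LinearOrder ι := linearOrderOfSTO WellOrderingRel
  have wf : WellFounded ((· < ·) : ι → ι → Prop) := WellOrderingRel.isWellOrder.wf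
  choose e he_mem he_le using fun i q => (hD i).2 q
  let U (i : ι) (rec : ∀ j, j < i → Set ((lam.out × η.out) × Bool)) :
      Set ((lam.out × η.out) × Bool) := p.1 ∪ ⋃ j : {j // j < i}, rec j.1 j.2
  let F (i : ι) (rec : ∀ j, j < i → Set ((lam.out × η.out) × Bool)) :
      Set ((lam.out × η.out) × Bool) :=
    if h : IsCond η (U i rec) then (e i ⟨U i rec, h⟩).1 else U i rec
  let s : ι → Set ((lam.out × η.out) × Bool) := wf.fix F
  let V (i : ι) : Set ((lam.out × η.out) × Bool) := p.1 ∪ ⋃ j : {j // j < i}, s j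
  have hs (i : ι) : s i = if h : IsCond η (V i) then (e i ⟨V i, h⟩).1 else V i := wf.fix_eq F i
  have hVs (i : ι) : V i ⊆ s i := by
    rw [hs]
    split_ifs with h
    · exact he_le i ⟨V i, h⟩
    · exact subset_rfl
  have hps (i : ι) : p.1 ⊆ s i := subset_union_left.trans (hVs i)
  have hmono {i j : ι} (hij : i < j) : s i ⊆ s j :=
    (subset_iUnion (fun k : {k // k < j} => s k) ⟨i, hij⟩).trans
      (subset_union_right.trans (hVs j))
  have hdir (i j : ι) : s i ⊆ s j ∨ s j ⊆ s i := by
    rcases lt_trichotomy i j with h | rfl | h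
    · exact .inl (hmono h)
    · exact .inl subset_rfl
    · exact .inr (hmono h)
  have hVcond (i : ι) : IsCond η (V i) := by
    induction i using wf.induction with
    | _ i ih =>
      refine isCond_union_iUnion hη ((mk_subtype_le _).trans_lt hι) p.2 (fun j => ?_)
        (fun j => hps j) fun j k => hdir j k
      rw [hs, dif_pos (ih j.1 j.2)]
      exact (e _ _).2
  have hs' (i : ι) : s i = (e i ⟨V i, hVcond i⟩).1 := by rw [hs, dif_pos]
  have hcond : IsCond η (p.1 ∪ ⋃ i, s i) :=
    isCond_union_iUnion hη hι p.2 (fun i => by rw [hs']; exact (e _ _).2) hps hdir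
  refine ⟨⟨_, hcond⟩, subset_union_left, fun i => (hD i).1 _ (he_mem i ⟨V i, hVcond i⟩) _ ?_⟩
  have h : s i ⊆ p.1 ∪ ⋃ i, s i := (subset_iUnion s i).trans subset_union_right
  rw [hs'] at h
  exact h

theorem descDist_of_cof_lt_cof {κ : Cardinal.{u}} (hη : ℵ₀ ≤ η) (hκ : ℵ₀ ≤ κ)
    (h : κ.ord.cof < η.ord.cof) : DescDist (AddCond η lam) κ := by
  intro D hD hanti
  obtain ⟨ι, f, hι, hf, hcof, -⟩ := exists_cofinal_family (isSuccLimit_ord hκ)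
  refine ⟨fun p hp q hqp => mem_iInter₂.2 fun α hα => (hD α hα).1 p (mem_iInter₂.1 hp α hα) q hqp,
    fun p => ?_⟩
  obtain ⟨q, hqp, hq⟩ := exists_forall_mem_of_mk_lt_cof hη (hι.trans_lt h) (fun i => D (f i))
    (fun i => hD _ (hf i)) p
  refine ⟨q, mem_iInter₂.2 fun α hα => ?_, hqp⟩
  obtain ⟨i, hi⟩ := hcof α hα
  exact hanti _ _ hi.le (hf i) (hq i)

/-- The domain of a condition. -/
def dom (p : AddCond η lam) : Set (lam.out × η.out) := Prod.fst '' p.1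

theorem mk_dom_lt (p : AddCond η lam) : #p.dom < η := p.2.2

theorem mem_dom {p : AddCond η lam} {x : lam.out × η.out} {b : Bool} (h : (x, b) ∈ p.1) :
    x ∈ p.dom := ⟨_, h, rfl⟩

theorem exists_le_of_mk_lt (hη : ℵ₀ ≤ η) (p : AddCond η lam) {B : Set (lam.out × η.out)}
    (hB : #B < η) (v : lam.out × η.out → Bool) :
    ∃ q ≤ p, ∀ x ∈ B, x ∉ p.dom → (x, v x) ∈ q.1 := by
  refine ⟨⟨p.1 ∪ (fun x => (x, v x)) '' (B \ p.dom), ?_, ?_⟩, subset_union_left,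
    fun x hx hxp => .inr ⟨x, ⟨hx, hxp⟩, rfl⟩⟩
  · rintro a b b' (hb | ⟨x, hx, hxb⟩) (hb' | ⟨y, hy, hyb⟩)
    · exact p.2.1 a b b' hb hb'
    · obtain ⟨rfl, rfl⟩ := Prod.mk.inj hyb
      exact absurd (mem_dom hb) hy.2
    · obtain ⟨rfl, rfl⟩ := Prod.mk.inj hxb
      exact absurd (mem_dom hb') hx.2
    · obtain ⟨rfl, rfl⟩ := Prod.mk.inj hxb
      exact congrArg v (Prod.mk.inj hyb).1.symm ▸ (Prod.mk.inj hyb).2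
  · rw [image_union]
    refine (mk_union_le _ _).trans_lt (add_lt_of_lt hη p.2.2 ?_)
    exact mk_image_le.trans_lt <| mk_image_le.trans_lt <|
      (mk_le_mk_of_subset sdiff_subset).trans_lt hB

theorem nonempty (hη : ℵ₀ ≤ η) : Nonempty (AddCond η lam) :=
  ⟨⟨∅, by simp, by simpa using aleph0_pos.trans_le hη⟩⟩

theorem le_of_powerlt_eq (hlam : lam ^< η = lam) (hlam' : ℵ₀ ≤ lam) : η ≤ lam := by
  by_contra! h
  exact (cantor' lam (one_lt_aleph0.trans_le hlam')).not_ge ((le_powerlt lam h).trans_eq hlam)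

theorem mk_le (hη : ℵ₀ ≤ η) (hlam : lam ^< η = lam) (hlam' : ℵ₀ ≤ lam) :
    #(AddCond η lam) ≤ lam := by
  have hηlam := le_of_powerlt_eq hlam hlam'
  have hX : #((lam.out × η.out) × Bool) = lam := by
    simp only [mk_prod, mk_out, Cardinal.lift_id, mk_bool, Cardinal.lift_uzero, Cardinal.lift_ofNat]
    rw [mul_eq_left hlam' hηlam (aleph0_pos.trans_le hη).ne',
      mul_eq_left hlam' (ofNat_lt_aleph0.le.trans hlam') two_ne_zero]
  have hgraph (p : AddCond η lam) : #p.1 < η := by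
    refine lt_of_eq_of_lt (mk_image_eq_of_injOn _ _ ?_).symm p.2.2
    rintro ⟨a, b⟩ hb ⟨a', b'⟩ hb' (rfl : a = a')
    rw [p.2.1 a b b' hb hb']
  let S (i : η.ord.ToType) : Set (Set ((lam.out × η.out) × Bool)) :=
    {t | #t ≤ (i.toOrd : Ordinal).card}
  have hS (i : η.ord.ToType) : #(S i) ≤ lam := by
    refine (mk_bounded_set_le _ (i.toOrd : Ordinal).card).trans ?_
    rw [hX, max_eq_left hlam']
    exact (le_powerlt lam (lt_ord.1 i.toOrd.2)).trans_eq hlam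
  have hsub : #(AddCond η lam) ≤ #(⋃ i, S i) := by
    refine mk_le_of_injective (f := fun p => ⟨p.1, mem_iUnion.2
      ⟨ToType.mk ⟨(#p.1).ord, ord_lt_ord.2 (hgraph p)⟩, ?_⟩⟩) ?_
    · simp [S]
    · intro p q h
      exact Subtype.ext (Subtype.mk.inj h)
  refine hsub.trans ((mk_iUnion_le S).trans ?_)
  rw [mk_ord_toType]
  exact (mul_le_mul' hηlam (ciSup_le' hS)).trans_eq (mul_eq_self hlam')

theorem not_descDist_of_le_cof {κ : Cardinal.{u}} (hη : ℵ₀ ≤ η) (hκ : ℵ₀ ≤ κ)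
    (hηκ : η ≤ κ.ord.cof) (hκlam : κ.ord.cof ≤ lam) : ¬ DescDist (AddCond η lam) κ := by
  have := nonempty (lam := lam) hη
  rw [← mk_out κ.ord.cof, ← mk_out lam] at hκlam
  obtain ⟨e⟩ := hκlam
  obtain ⟨z⟩ : Nonempty η.out := by
    rw [← mk_ne_zero_iff, mk_out]
    exact (aleph0_pos.trans_le hη).ne'
  refine not_descDist_of_relation hκ (mk_out _) (fun p γ => (e γ, z) ∈ p.dom) ?_ ?_ ?_
  · exact fun p q γ hqp h => image_mono hqp h
  · intro p γ
    by_cases hγ : (e γ, z) ∈ p.dom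
    · exact ⟨p, le_rfl, hγ⟩
    · obtain ⟨q, hqp, hq⟩ := exists_le_of_mk_lt hη p (B := {(e γ, z)})
        (by simpa using one_lt_aleph0.trans_le hη) fun _ => true
      exact ⟨q, hqp, mem_dom (hq _ rfl hγ)⟩
  · intro p
    refine lt_of_le_of_lt ?_ (p.mk_dom_lt.trans_le hηκ)
    exact mk_le_of_injective (f := fun γ => ⟨(e γ.1, z), γ.2⟩) fun γ γ' h =>
      Subtype.ext (e.injective (Prod.mk.inj (Subtype.mk.inj h)).1)

theorem _root_.Cardinal.IsSingular.exists_cofinal_family (hη : η.IsSingular) :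
    ∃ (ι : Type u) (χ : ι → Cardinal.{u}), #ι = η.ord.cof ∧ (∀ i, ℵ₀ ≤ χ i) ∧
      (∀ i, χ i < η) ∧ (∀ μ < η, ∃ i, μ < χ i) ∧ ∀ μ < η, #{i // χ i ≤ μ} < η.ord.cof := by
  have hω : ℵ₀ < η := hη.aleph0_le.lt_of_ne fun h => not_isSingular_aleph0 (h ▸ hη)
  obtain ⟨ι, f, hι, hf, hcof, hsmall⟩ :=
    Ordinal.exists_cofinal_family (isSuccLimit_ord hη.aleph0_le)
  have hsucc {μ : Cardinal.{u}} (hμ : μ < η) : (Order.succ μ).ord < η.ord :=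
    ord_lt_ord.2 (hη.isSuccLimit.succ_lt hμ)
  refine ⟨ι, fun i => max (f i).card ℵ₀, hι, fun i => le_max_right _ _,
    fun i => max_lt (lt_ord.1 (hf i)) hω, fun μ hμ => ?_, fun μ hμ => ?_⟩
  · obtain ⟨i, hi⟩ := hcof _ (hsucc hμ)
    exact ⟨i, lt_max_of_lt_left ((Order.lt_succ μ).trans_le (ord_le.1 hi.le))⟩
  · refine (mk_subtype_le_of_subset fun i (hi : max _ _ ≤ μ) => ?_).trans_lt (hsmall _ (hsucc hμ))
    exact (lt_ord.2 (Order.lt_succ_of_le (le_of_max_le_left hi))).le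

/-- Given disjoint pieces of the set of coordinates indexed by `Γ`, the condition `p` marks `γ` if
it has value `1` on almost all of the piece of `γ`, and value `0` at `χ` many points of every other
piece. -/
def Marks {Γ : Type u} (piece : Γ → Set (lam.out × η.out)) (χ : Cardinal.{u}) (p : AddCond η lam)
    (γ : Γ) : Prop :=
  (∀ γ' ≠ γ, χ ≤ #{x | x ∈ piece γ' ∧ (x, false) ∈ p.1}) ∧
    #{x | x ∈ piece γ ∧ (x, true) ∉ p.1} < χ

section Marks

variable {Γ : Type u} {piece : Γ → Set (lam.out × η.out)} {χ : Cardinal.{u}}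

theorem Marks.mono {p q : AddCond η lam} {γ : Γ} (hqp : q ≤ p) (h : Marks piece χ p γ) :
    Marks piece χ q γ :=
  ⟨fun γ' hγ' => (h.1 γ' hγ').trans (mk_le_mk_of_subset fun _ hx => ⟨hx.1, hqp hx.2⟩),
    lt_of_le_of_lt (mk_subtype_le_of_subset fun _ hx => ⟨hx.1, fun hxp => hx.2 (hqp hxp)⟩) h.2⟩

theorem Marks.unique {p : AddCond η lam} {γ γ' : Γ} (h : Marks piece χ p γ)
    (h' : Marks piece χ p γ') : γ = γ' := by
  by_contra hne
  refine (h'.1 γ hne).not_gt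
    (lt_of_le_of_lt (mk_subtype_le_of_subset fun x hx => ⟨hx.1, fun hxp => ?_⟩) h.2)
  exact Bool.false_ne_true (p.2.1 x _ _ hx.2 hxp)

theorem Marks.le_mk_dom [Nontrivial Γ] {p : AddCond η lam} {γ : Γ} (h : Marks piece χ p γ) :
    χ ≤ #p.dom := by
  obtain ⟨γ', hγ'⟩ := exists_ne γ
  exact (h.1 γ' hγ').trans (mk_le_mk_of_subset fun x hx => mem_dom hx.2)

theorem exists_le_marks (hη : ℵ₀ ≤ η) (hΓ : #Γ < η) (hχ : ℵ₀ ≤ χ) (hχη : χ < η)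
    (hpiece : ∀ γ, #(piece γ) = χ) (hdisj : Pairwise fun γ γ' => Disjoint (piece γ) (piece γ'))
    {p : AddCond η lam} (hp : #p.dom < χ) (γ : Γ) : ∃ q ≤ p, Marks piece χ q γ := by
  classical
  have hB : #(⋃ γ, piece γ) < η :=
    (mk_iUnion_le piece).trans_lt <| mul_lt_of_lt hη hΓ <|
      (ciSup_le' fun γ => (hpiece γ).le).trans_lt hχη
  obtain ⟨q, hqp, hq⟩ := exists_le_of_mk_lt hη p hB fun x => decide (x ∈ piece γ)
  refine ⟨q, hqp, fun γ' hγ' => ?_, lt_of_le_of_lt (mk_le_mk_of_subset fun x hx => ?_) hp⟩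
  · by_contra! hlt
    have hle : #(piece γ' \ p.dom : Set _) ≤ #{x | x ∈ piece γ' ∧ (x, false) ∈ q.1} := by
      refine mk_le_mk_of_subset fun x hx => ⟨hx.1, ?_⟩
      have := hq x (mem_iUnion.2 ⟨γ', hx.1⟩) hx.2
      rwa [decide_eq_false ((hdisj hγ').notMem_of_mem_left hx.1)] at this
    have := le_mk_sdiff_add_mk (piece γ') p.dom
    rw [hpiece] at this
    exact this.not_gt (add_lt_of_lt hχ (hle.trans_lt hlt) hp)
  · by_contra hxp
    refine hx.2 ?_
    have := hq x (mem_iUnion.2 ⟨γ, hx.1⟩) hxp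
    rwa [decide_eq_true hx.1] at this

end Marks

theorem not_descDist_of_cof_lt {κ : Cardinal.{u}} (hη : ℵ₀ ≤ η) (hκ : ℵ₀ ≤ κ) (hηlam : η ≤ lam)
    (hηκ : η.ord.cof ≤ κ.ord.cof) (hκη : κ.ord.cof < η) : ¬ DescDist (AddCond η lam) κ := by
  have := nonempty (lam := lam) hη
  have hδ : ℵ₀ ≤ κ.ord.cof := aleph0_le_cof_iff.2 (one_lt_cof_iff.2 (isSuccLimit_ord hκ))
  obtain ⟨ι, χ, hι, hχ, hχη, hχcof, hχsmall⟩ :=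
    IsSingular.exists_cofinal_family ⟨hη, (hηκ.trans_lt hκη).ne⟩
  let Γ : Type u := κ.ord.cof.out
  have hΓ : #Γ = κ.ord.cof := mk_out _
  have : Infinite Γ := infinite_iff.2 (hΓ ▸ hδ)
  obtain ⟨e⟩ : #(ι × Γ) ≤ #lam.out := by
    rw [mk_prod, Cardinal.lift_id, Cardinal.lift_id, hι, hΓ, mk_out]
    exact (mul_le_mul_left hηκ _).trans <| (mul_eq_self hδ).le.trans (hκη.le.trans hηlam)
  have hT (i : ι) : ∃ T : Set η.out, #T = χ i :=
    le_mk_iff_exists_set.1 ((hχη i).le.trans_eq (mk_out η).symm)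
  choose T hT using hT
  let piece (i : ι) (γ : Γ) : Set (lam.out × η.out) := Prod.mk (e (i, γ)) '' T i
  have hpiece (i : ι) (γ : Γ) : #(piece i γ) = χ i := by
    rw [mk_image_eq (Prod.mk_right_injective _), hT]
  have hdisj (i : ι) : Pairwise fun γ γ' => Disjoint (piece i γ) (piece i γ') := by
    refine fun γ γ' hne => Set.disjoint_left.2 ?_
    rintro _ ⟨y, -, rfl⟩ ⟨y', -, h⟩
    exact hne (Prod.mk.inj (e.injective (Prod.mk.inj h).1)).2.symm
  refine not_descDist_of_relation hκ hΓ (fun p γ => ∃ i, Marks (piece i) (χ i) p γ) ?_ ?_ ?_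
  · exact fun p q γ hqp ⟨i, hi⟩ => ⟨i, hi.mono hqp⟩
  · intro p γ
    obtain ⟨i, hi⟩ := hχcof _ p.mk_dom_lt
    obtain ⟨q, hqp, hq⟩ :=
      exists_le_marks hη (hΓ.trans_lt hκη) (hχ i) (hχη i) (hpiece i) (hdisj i) hi γ
    exact ⟨q, hqp, i, hq⟩
  · intro p
    refine lt_of_le_of_lt ?_ ((hχsmall _ p.mk_dom_lt).trans_le hηκ)
    refine mk_le_of_injective (f := fun γ => ⟨γ.2.choose, γ.2.choose_spec.le_mk_dom⟩) ?_
    intro γ γ' h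
    have h' := γ'.2.choose_spec
    rw [← Subtype.mk.inj h] at h'
    exact Subtype.ext (γ.2.choose_spec.unique h')

end AddCond

end

/-- If `λ^{<η} = λ ≥ ℵ₀` then `Add(η,λ)` is `κ`-descending distributive if and only if
`cf(κ) < cf(η)` or `cf(κ) > λ^{<η}`. -/
theorem statement8 (η lam : Cardinal.{u}) (hη : ℵ₀ ≤ η)
    (hlam : lam ^< η = lam) (hlam' : ℵ₀ ≤ lam)
    (κ : Cardinal.{u}) (hκ : ℵ₀ ≤ κ) :
    DescDist (AddCond η lam) κ ↔
      (κ.ord.cof < η.ord.cof ∨ lam ^< η < κ.ord.cof) := by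
  have hηlam := AddCond.le_of_powerlt_eq hlam hlam'
  rw [hlam]
  constructor
  · intro h
    by_contra! hcof
    rcases lt_or_ge κ.ord.cof η with hκη | hκη
    · exact AddCond.not_descDist_of_cof_lt hη hκ hηlam hcof.1 hκη h
    · exact AddCond.not_descDist_of_le_cof hη hκ hκη hcof.2 h
  · rintro (h | h)
    · exact AddCond.descDist_of_cof_lt_cof hη hκ h
    · exact descDist_of_mk_lt_cof ((AddCond.mk_le hη hlam hlam').trans_lt h)
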